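/- (0-optimum exponent for countable mixtures.) Let 𝒳 be a finite alphabet. Let {P_i}_{i=1}^∞ and {P̄_j}_{j=1}^∞ be distributions on 𝒳 with P̄_j(x) > 0 for all j and x, and let w_i > 0, v_j > 0 be probability weights with Σ_i w_i = Σ_j v_j = 1. Define the mixed memoryless sources P_{X^n}(x) = Σ_{i=1}^∞ w_i ∏_{k=1}^n P_i(x_k) and P_{X̄^n}(x) = Σ_{j=1}^∞ v_j ∏_{k=1}^n P̄_j(x_k). Assume that for each i there exists j(i) attaining inf_{j} D(P_i‖P̄_j). Then B_0(X‖X̄) = inf_{i,j ≥ 1} D(P_i‖P̄_j). -/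

import Mathlib

open scoped BigOperators

/-- Probability of a set `A` under a distribution `P` on a finite type. -/
noncomputable def prob {α : Type*} [Fintype α] (P : α → ℝ) (A : Set α) : ℝ :=
  ∑ x, A.indicator P x

/-- Type I error probability `μ_n = Pr{X^n ∉ A_n}` of the acceptance regions `A`
for the general source `X`. -/
noncomputable def typeI {𝒳 : Type*} [Fintype 𝒳] (X : (n : ℕ) → (Fin n → 𝒳) → ℝ)
    (A : (n : ℕ) → Set (Fin n → 𝒳)) (n : ℕ) : ℝ :=
  prob (X n) ((A n)ᶜ)

/-- Type II error probability `λ_n = Pr{X̄^n ∈ A_n}` of the acceptance regions `A`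
for the general source `X̄`. -/
noncomputable def typeII {𝒳 : Type*} [Fintype 𝒳] (Xbar : (n : ℕ) → (Fin n → 𝒳) → ℝ)
    (A : (n : ℕ) → Set (Fin n → 𝒳)) (n : ℕ) : ℝ :=
  prob (Xbar n) (A n)

/-- `R` is `ε`-achievable: there are acceptance regions with
`limsup μ_n ≤ ε` and `liminf (1/n) log (1/λ_n) ≥ R`. -/
def EpsAchievable {𝒳 : Type*} [Fintype 𝒳] (X Xbar : (n : ℕ) → (Fin n → 𝒳) → ℝ)
    (ε R : ℝ) : Prop :=
  ∃ A : (n : ℕ) → Set (Fin n → 𝒳),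
    Filter.limsup (typeI X A) Filter.atTop ≤ ε ∧
    R ≤ Filter.liminf (fun n : ℕ => (1 / (n : ℝ)) * Real.log (1 / typeII Xbar A n))
      Filter.atTop

/-- The first-order `ε`-optimum exponent `B_ε(X‖X̄)`. -/
noncomputable def Beps {𝒳 : Type*} [Fintype 𝒳]
    (X Xbar : (n : ℕ) → (Fin n → 𝒳) → ℝ) (ε : ℝ) : ℝ :=
  sSup {R : ℝ | EpsAchievable X Xbar ε R}

/-- Kullback–Leibler divergence `D(P‖Q) = ∑_x P(x) log (P(x)/Q(x))` on a finite alphabet. -/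
noncomputable def KL {𝒳 : Type*} [Fintype 𝒳] (P Q : 𝒳 → ℝ) : ℝ :=
  ∑ x, P x * Real.log (P x / Q x)

/-- The first-order `0`-optimum exponent `B_0(X‖X̄)`. -/
noncomputable def B0 {𝒳 : Type*} [Fintype 𝒳]
    (X Xbar : (n : ℕ) → (Fin n → 𝒳) → ℝ) : ℝ :=
  Beps X Xbar 0

section aux
open Filter Topology

noncomputable def cnt {𝒳 : Type*} {n : ℕ} (x : Fin n → 𝒳) (a : 𝒳) : ℝ :=
  ∑ k, Set.indicator {a} (fun _ => (1 : ℝ)) (x k)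

def Typ {𝒳 : Type*} (p : 𝒳 → ℝ) (ε : ℝ) (n : ℕ) : Set (Fin n → 𝒳) :=
  {x | ∀ a, |cnt x a - n * p a| ≤ ε * (n * p a)}

variable {𝒳 : Type*} [Fintype 𝒳]

lemma sum_prod_one (p : 𝒳 → ℝ) (h1 : ∑ x, p x = 1) (n : ℕ) :
    ∑ x : Fin n → 𝒳, ∏ k, p (x k) = 1 := by
  rw [← Fintype.sum_pow, h1, one_pow]

lemma sum_cons (n : ℕ) (F : (Fin (n + 1) → 𝒳) → ℝ) :
    ∑ x, F x = ∑ a, ∑ y : Fin n → 𝒳, F (Fin.cons a y) := by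
  rw [← Fintype.sum_prod_type' (f := fun a y => F (Fin.cons a y))]
  exact (Fintype.sum_equiv (Fin.consEquiv (fun _ => 𝒳)) _ _ (fun x => rfl)).symm

lemma moments (p h : 𝒳 → ℝ) (h1 : ∑ x, p x = 1) (hm : ∑ x, p x * h x = 0) (n : ℕ) :
    ∑ x : Fin n → 𝒳, (∏ k, p (x k)) * (∑ k, h (x k)) = 0 ∧
    ∑ x : Fin n → 𝒳, (∏ k, p (x k)) * (∑ k, h (x k)) ^ 2 = n * ∑ x, p x * h x ^ 2 := by
  induction n with
  | zero => simp
  | succ n ih =>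
    obtain ⟨ih1, ih2⟩ := ih
    have h0 := sum_prod_one p h1 n
    constructor
    · rw [sum_cons]
      have : ∀ a, ∑ y : Fin n → 𝒳, (∏ k, p (Fin.cons (α := fun _ => 𝒳) a y k)) *
          (∑ k, h (Fin.cons (α := fun _ => 𝒳) a y k)) = p a * h a := by
        intro a
        calc _ = ∑ y : Fin n → 𝒳, (p a * h a * (∏ k, p (y k)) +
              p a * ((∏ k, p (y k)) * ∑ k, h (y k))) := by
              refine Finset.sum_congr rfl fun y _ => ?_
              simp only [Fin.prod_univ_succ, Fin.sum_univ_succ, Fin.cons_zero, Fin.cons_succ]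
              ring
          _ = _ := by
              rw [Finset.sum_add_distrib, ← Finset.mul_sum, ← Finset.mul_sum, h0, ih1]; ring
      simp only [this, hm]
    · rw [sum_cons]
      have : ∀ a, ∑ y : Fin n → 𝒳, (∏ k, p (Fin.cons (α := fun _ => 𝒳) a y k)) *
          (∑ k, h (Fin.cons (α := fun _ => 𝒳) a y k)) ^ 2 =
            p a * h a ^ 2 + p a * (n * ∑ x, p x * h x ^ 2) := by
        intro a
        calc _ = ∑ y : Fin n → 𝒳, (p a * h a ^ 2 * (∏ k, p (y k)) +
              2 * p a * h a * ((∏ k, p (y k)) * ∑ k, h (y k)) +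
              p a * ((∏ k, p (y k)) * (∑ k, h (y k)) ^ 2)) := by
              refine Finset.sum_congr rfl fun y _ => ?_
              simp only [Fin.prod_univ_succ, Fin.sum_univ_succ, Fin.cons_zero, Fin.cons_succ]
              ring
          _ = _ := by
              rw [Finset.sum_add_distrib, Finset.sum_add_distrib, ← Finset.mul_sum,
                ← Finset.mul_sum, ← Finset.mul_sum, h0, ih1, ih2]; ring
      simp only [this]
      rw [Finset.sum_add_distrib, ← Finset.sum_mul, h1]
      push_cast; ring

lemma prob_nonneg {α : Type*} [Fintype α] (q : α → ℝ) (hq : ∀ x, 0 ≤ q x) (A : Set α) :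
    0 ≤ prob q A :=
  Finset.sum_nonneg fun x _ => Set.indicator_nonneg (fun x _ => hq x) x

lemma prob_mono {α : Type*} [Fintype α] (q : α → ℝ) (hq : ∀ x, 0 ≤ q x) {A B : Set α}
    (h : A ⊆ B) : prob q A ≤ prob q B :=
  Finset.sum_le_sum fun x _ => Set.indicator_le_indicator_of_subset h hq x

lemma prob_compl {α : Type*} [Fintype α] (q : α → ℝ) (A : Set α) :
    prob q A + prob q Aᶜ = ∑ x, q x := by
  unfold prob
  rw [← Finset.sum_add_distrib]
  refine Finset.sum_congr rfl fun x _ => ?_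
  by_cases hx : x ∈ A <;> simp [hx]

lemma prob_union {α : Type*} [Fintype α] (q : α → ℝ) (hq : ∀ x, 0 ≤ q x) (A B : Set α) :
    prob q (A ∪ B) ≤ prob q A + prob q B := by
  unfold prob
  rw [← Finset.sum_add_distrib]
  refine Finset.sum_le_sum fun x _ => ?_
  by_cases hx : x ∈ A <;> by_cases hy : x ∈ B <;> simp [hx, hy, hq x]

lemma prob_iUnion {α ι : Type*} [Fintype α] [Fintype ι] (q : α → ℝ) (hq : ∀ x, 0 ≤ q x)
    (A : ι → Set α) : prob q (⋃ i, A i) ≤ ∑ i, prob q (A i) := by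
  unfold prob
  rw [Finset.sum_comm]
  refine Finset.sum_le_sum fun x _ => ?_
  by_cases hx : x ∈ ⋃ i, A i
  · obtain ⟨i, hi⟩ := Set.mem_iUnion.1 hx
    rw [Set.indicator_of_mem hx]
    calc q x = (A i).indicator q x := by rw [Set.indicator_of_mem hi]
      _ ≤ _ := Finset.single_le_sum (f := fun i => (A i).indicator q x)
        (fun i _ => Set.indicator_nonneg (fun x _ => hq x) x) (Finset.mem_univ i)
  · rw [Set.indicator_of_notMem hx]
    exact Finset.sum_nonneg fun i _ => Set.indicator_nonneg (fun x _ => hq x) x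

lemma cheb (p h : 𝒳 → ℝ) (h0 : ∀ x, 0 ≤ p x) (h1 : ∑ x, p x = 1) (hm : ∑ x, p x * h x = 0)
    (η : ℝ) (hη : 0 < η) (n : ℕ) (hn : 0 < n) :
    prob (fun x : Fin n → 𝒳 => ∏ k, p (x k)) {x | n * η < |∑ k, h (x k)|} ≤
      ((∑ x, p x * h x ^ 2) / η ^ 2) / n := by
  have hn' : (0 : ℝ) < n := by exact_mod_cast hn
  have h2 := (moments p h h1 hm n).2
  rw [div_div, le_div_iff₀ (by positivity)]
  have : prob (fun x : Fin n → 𝒳 => ∏ k, p (x k)) {x | n * η < |∑ k, h (x k)|} * (n * η) ^ 2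
      ≤ n * ∑ x, p x * h x ^ 2 := by
    rw [← h2]
    unfold prob
    rw [Finset.sum_mul]
    refine Finset.sum_le_sum fun x _ => ?_
    have hq : 0 ≤ ∏ k, p (x k) := Finset.prod_nonneg fun k _ => h0 _
    by_cases hx : x ∈ {x : Fin n → 𝒳 | n * η < |∑ k, h (x k)|}
    · rw [Set.indicator_of_mem hx]
      refine mul_le_mul_of_nonneg_left ?_ hq
      rw [← sq_abs (∑ k, h (x k))]
      exact pow_le_pow_left₀ (by positivity) (le_of_lt hx) 2
    · rw [Set.indicator_of_notMem hx]
      simp only [zero_mul]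
      positivity
  have h3 : n * (prob (fun x : Fin n → 𝒳 => ∏ k, p (x k)) {x | n * η < |∑ k, h (x k)|}
      * (η ^ 2 * n)) ≤ n * ∑ x, p x * h x ^ 2 := by
    refine le_trans (le_of_eq ?_) this
    ring
  exact le_of_mul_le_mul_left h3 hn'

lemma typ_tendsto (p : 𝒳 → ℝ) (h0 : ∀ x, 0 ≤ p x) (h1 : ∑ x, p x = 1) (ε : ℝ) (hε : 0 < ε) :
    Tendsto (fun n : ℕ => prob (fun x : Fin n → 𝒳 => ∏ k, p (x k)) (Typ p ε n)ᶜ) atTop (𝓝 0) := by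
  have hq : ∀ n, ∀ x : Fin n → 𝒳, 0 ≤ ∏ k, p (x k) :=
    fun n x => Finset.prod_nonneg fun k _ => h0 _
  let E : (n : ℕ) → 𝒳 → Set (Fin n → 𝒳) := fun n a => {x | ε * (n * p a) < |cnt x a - n * p a|}
  have key : ∀ a, Tendsto (fun n : ℕ => prob (fun x : Fin n → 𝒳 => ∏ k, p (x k)) (E n a))
      atTop (𝓝 0) := by
    intro a
    rcases (h0 a).eq_or_lt with ha | ha
    · have : ∀ n, prob (fun x : Fin n → 𝒳 => ∏ k, p (x k)) (E n a) = 0 := by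
        intro n
        refine Finset.sum_eq_zero fun x _ => ?_
        by_cases hx : x ∈ E n a
        · rw [Set.indicator_of_mem hx]
          by_contra hne
          have hk : ∀ k, x k ≠ a := by
            intro k hk
            exact hne (Finset.prod_eq_zero (Finset.mem_univ k) (by rw [hk, ← ha]))
          have : cnt x a = 0 := Finset.sum_eq_zero fun k _ => by simp [hk k]
          simp [E, ← ha, this] at hx
        · rw [Set.indicator_of_notMem hx]
      simp only [this]
      exact tendsto_const_nhds
    · let h : 𝒳 → ℝ := fun b => Set.indicator {a} (fun _ => (1 : ℝ)) b - p a
      have hm : ∑ x, p x * h x = 0 := by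
        simp only [h, mul_sub, Finset.sum_sub_distrib, ← Finset.sum_mul, h1]
        rw [Finset.sum_eq_single a]
        · simp
        · intro b _ hb; simp [hb]
        · simp
      have hs : ∀ n (x : Fin n → 𝒳), ∑ k, h (x k) = cnt x a - n * p a := by
        intro n x
        simp [h, cnt, Finset.sum_sub_distrib]
      refine squeeze_zero' (Eventually.of_forall fun n => prob_nonneg _ (hq n) _)
        (g := fun n : ℕ => ((∑ x, p x * h x ^ 2) / (ε * p a) ^ 2) / n) ?_
        (tendsto_const_div_atTop_nhds_zero_nat _)
      filter_upwards [eventually_gt_atTop 0] with n hn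
      refine le_trans (le_of_eq ?_) (cheb p h h0 h1 hm (ε * p a) (by positivity) n hn)
      congr 1
      ext x
      simp only [E, Set.mem_ofPred_eq, hs]
      rw [show ε * (n * p a) = n * (ε * p a) by ring]
  refine squeeze_zero (fun n => prob_nonneg _ (hq n) _)
    (g := fun n : ℕ => ∑ a, prob (fun x : Fin n → 𝒳 => ∏ k, p (x k)) (E n a)) ?_ ?_
  · intro n
    refine le_trans (prob_mono _ (hq n) ?_) (prob_iUnion _ (hq n) (E n))
    intro x hx
    simp only [Typ, Set.mem_compl_iff, Set.mem_ofPred_eq, not_forall, not_le] at hx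
    exact Set.mem_iUnion.2 hx
  · simpa using tendsto_finsetSum Finset.univ (fun a _ => key a)

lemma typ_sum (p : 𝒳 → ℝ) (ε : ℝ) (n : ℕ) (x : Fin n → 𝒳)
    (hx : x ∈ Typ p ε n) (g : 𝒳 → ℝ) :
    |∑ k, g (x k) - n * ∑ a, p a * g a| ≤ ε * (n * ∑ a, p a * |g a|) := by
  have h : ∑ k, g (x k) = ∑ a, cnt x a * g a := by
    simp only [cnt, Finset.sum_mul]
    rw [Finset.sum_comm]
    refine Finset.sum_congr rfl fun k _ => ?_
    rw [Finset.sum_eq_single (x k)]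
    · simp
    · intro b _ hb; simp [hb.symm]
    · simp
  rw [h, Finset.mul_sum, ← Finset.sum_sub_distrib, Finset.mul_sum, Finset.mul_sum]
  refine (Finset.abs_sum_le_sum_abs _ _).trans (Finset.sum_le_sum fun a _ => ?_)
  rw [show cnt x a * g a - n * (p a * g a) = (cnt x a - n * p a) * g a by ring, abs_mul]
  calc _ ≤ ε * (n * p a) * |g a| := mul_le_mul_of_nonneg_right (hx a) (abs_nonneg _)
    _ = _ := by ring

lemma typ_pos (p : 𝒳 → ℝ) (h0 : ∀ x, 0 ≤ p x) (ε : ℝ) (n : ℕ) (x : Fin n → 𝒳)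
    (hx : x ∈ Typ p ε n) (k : Fin n) : 0 < p (x k) := by
  refine (h0 _).lt_of_ne fun h => ?_
  have h2 := hx (x k)
  rw [← h] at h2
  simp only [mul_zero, sub_zero] at h2
  have h3 : 0 < cnt x (x k) := by
    unfold cnt
    refine Finset.sum_pos' (fun k _ => Set.indicator_nonneg (fun _ _ => zero_le_one) _)
      ⟨k, Finset.mem_univ k, by simp⟩
  linarith [le_abs_self (cnt x (x k))]

lemma prod_exp {n : ℕ} (p : 𝒳 → ℝ) (x : Fin n → 𝒳) (h : ∀ k, 0 < p (x k)) :
    ∏ k, p (x k) = Real.exp (∑ k, Real.log (p (x k))) := by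
  rw [Real.exp_sum]
  exact Finset.prod_congr rfl fun k _ => (Real.exp_log (h k)).symm

lemma prod_le_one' (p : 𝒳 → ℝ) (h0 : ∀ x, 0 ≤ p x) (h1 : ∑ x, p x = 1) {n : ℕ}
    (x : Fin n → 𝒳) : ∏ k, p (x k) ≤ 1 := by
  refine Finset.prod_le_one (fun k _ => h0 _) fun k _ => ?_
  rw [← h1]
  exact Finset.single_le_sum (fun a _ => h0 a) (Finset.mem_univ _)

lemma mix_summable {q : ℕ → ℝ} {w : ℕ → ℝ} (hw : Summable w) (hw0 : ∀ i, 0 < w i)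
    (hq0 : ∀ i, 0 ≤ q i) (hq1 : ∀ i, q i ≤ 1) : Summable fun i => w i * q i :=
  Summable.of_nonneg_of_le (fun i => mul_nonneg (hw0 i).le (hq0 i))
    (fun i => mul_le_of_le_one_right (hw0 i).le (hq1 i)) hw

lemma mix_prob {α : Type*} [Fintype α] (q : ℕ → α → ℝ) (w : ℕ → ℝ) (hw : Summable w)
    (hw0 : ∀ i, 0 < w i) (hq0 : ∀ i x, 0 ≤ q i x) (hq1 : ∀ i x, q i x ≤ 1) (A : Set α) :
    prob (fun x => ∑' i, w i * q i x) A = ∑' i, w i * prob (q i) A := by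
  unfold prob
  simp only [Finset.mul_sum]
  have h0 : ∀ i x, 0 ≤ A.indicator (q i) x := fun i x =>
    Set.indicator_nonneg (fun x _ => hq0 i x) x
  have h1 : ∀ i x, A.indicator (q i) x ≤ 1 := fun i x => by
    by_cases hx : x ∈ A <;> simp [hx, hq1 i x]
  rw [Summable.tsum_finsetSum fun x _ =>
    mix_summable hw hw0 (fun i => h0 i x) (fun i => h1 i x)]
  refine Finset.sum_congr rfl fun x _ => ?_
  by_cases hx : x ∈ A <;> simp [hx]

lemma KL_nonneg' (p q : 𝒳 → ℝ) (h0 : ∀ x, 0 ≤ p x) (h1 : ∑ x, p x = 1)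
    (hq0 : ∀ x, 0 < q x) (hq1 : ∑ x, q x = 1) : 0 ≤ KL p q := by
  have : ∑ x, (p x - q x) ≤ KL p q := by
    refine Finset.sum_le_sum fun x _ => ?_
    rcases (h0 x).eq_or_lt with h | h
    · rw [← h]; simp [(hq0 x).le]
    · have h2 := Real.one_sub_inv_le_log_of_pos (div_pos h (hq0 x))
      have h3 := mul_le_mul_of_nonneg_left h2 h.le
      refine le_trans (le_of_eq ?_) h3
      have := hq0 x
      field_simp
  rw [Finset.sum_sub_distrib, h1, hq1] at this
  linarith

lemma KL_eq (p q : 𝒳 → ℝ) (hq0 : ∀ x, 0 < q x) :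
    KL p q = ∑ a, p a * Real.log (p a) - ∑ a, p a * Real.log (q a) := by
  unfold KL
  rw [← Finset.sum_sub_distrib]
  refine Finset.sum_congr rfl fun x _ => ?_
  by_cases h : p x = 0
  · simp [h]
  · rw [Real.log_div h (hq0 x).ne']; ring

lemma mix_le (q w : ℕ → ℝ) (hw : Summable w) (hw0 : ∀ i, 0 < w i)
    (hq0 : ∀ i, 0 ≤ q i) (hq1 : ∀ i, q i ≤ 1) (i : ℕ) : w i * q i ≤ ∑' i, w i * q i :=
  (mix_summable hw hw0 hq0 hq1).le_tsum i fun j _ => mul_nonneg (hw0 j).le (hq0 j)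

lemma prob_le_total {α : Type*} [Fintype α] (q : α → ℝ) (hq : ∀ x, 0 ≤ q x)
    (h1 : ∑ x, q x = 1) (A : Set α) : prob q A ≤ 1 := by
  have := prob_compl q A
  have := prob_nonneg q hq Aᶜ
  linarith

lemma converse_aux (P : ℕ → 𝒳 → ℝ) (Pbar : ℕ → 𝒳 → ℝ)
    (hP : ∀ i, (∀ x, 0 ≤ P i x) ∧ (∑ x, P i x) = 1)
    (hPbar : ∀ j, (∀ x, 0 < Pbar j x) ∧ (∑ x, Pbar j x) = 1)
    (wgt vgt : ℕ → ℝ)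
    (hw0 : ∀ i, 0 < wgt i) (hw : Summable wgt)
    (hv0 : ∀ j, 0 < vgt j) (hv : Summable vgt)
    (A : (n : ℕ) → Set (Fin n → 𝒳))
    (hI : ∀ c > 0, ∀ᶠ n in atTop, typeI (fun n x => ∑' i, wgt i * ∏ k, P i (x k)) A n < c)
    (i j : ℕ) (δ : ℝ) (hδ : 0 < δ) :
    ∀ᶠ n : ℕ in atTop, 0 < typeII (fun n x => ∑' j, vgt j * ∏ k, Pbar j (x k)) A n ∧
      (1 / (n : ℝ)) * Real.log (1 / typeII (fun n x => ∑' j, vgt j * ∏ k, Pbar j (x k)) A n)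
        ≤ KL (P i) (Pbar j) + δ := by
  obtain ⟨hp0, hp1⟩ := hP i
  obtain ⟨hq0, hq1⟩ := hPbar j
  set p := P i with hp
  set q := Pbar j with hq
  let L : 𝒳 → ℝ := fun a => Real.log (p a) - Real.log (q a)
  have hKL : ∑ a, p a * L a = KL p q := by
    rw [KL_eq p q hq0, ← Finset.sum_sub_distrib]
    exact Finset.sum_congr rfl fun a _ => by simp only [L]; ring
  set M := ∑ a, p a * |L a| with hM
  have hM0 : 0 ≤ M := Finset.sum_nonneg fun a _ => mul_nonneg (hp0 a) (abs_nonneg _)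
  set ε := δ / (2 * (M + 1)) with hε
  have hε0 : 0 < ε := by positivity
  have hεM : ε * M ≤ δ / 2 := by
    rw [hε, div_mul_eq_mul_div, div_le_iff₀ (by positivity)]
    nlinarith
  have hT := (typ_tendsto p hp0 hp1 ε hε0).eventually (gt_mem_nhds (show (0:ℝ) < 1/4 by norm_num))
  have hlog : ∀ᶠ n : ℕ in atTop, - Real.log (vgt j / 2) ≤ n * (δ / 2) :=
    (tendsto_natCast_atTop_atTop.atTop_mul_const (half_pos hδ)).eventually_ge_atTop _
  filter_upwards [hT, hlog, hI (wgt i / 4) (by have := hw0 i; positivity),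
    eventually_gt_atTop 0] with n hT hlog hI hn
  have hn' : (0 : ℝ) < n := by exact_mod_cast hn
  have hPn0 : ∀ i (x : Fin n → 𝒳), 0 ≤ ∏ k, P i (x k) :=
    fun i x => Finset.prod_nonneg fun k _ => (hP i).1 _
  have hQn0 : ∀ i (x : Fin n → 𝒳), 0 ≤ ∏ k, Pbar i (x k) :=
    fun i x => Finset.prod_nonneg fun k _ => ((hPbar i).1 _).le
  have e1 : wgt i * prob (fun x : Fin n → 𝒳 => ∏ k, p (x k)) (A n)ᶜ < wgt i / 4 := by
    refine lt_of_le_of_lt ?_ hI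
    unfold typeI
    rw [mix_prob (fun i x => ∏ k, P i (x k)) wgt hw hw0 hPn0
      (fun i x => prod_le_one' _ (hP i).1 (hP i).2 x)]
    exact mix_le (fun i => prob (fun x : Fin n → 𝒳 => ∏ k, P i (x k)) (A n)ᶜ) wgt hw hw0
      (fun i => prob_nonneg _ (hPn0 i) _)
      (fun i => prob_le_total _ (hPn0 i) (sum_prod_one _ (hP i).2 n) _) i
  have e1' : prob (fun x : Fin n → 𝒳 => ∏ k, p (x k)) (A n)ᶜ < 1 / 4 := by
    have := hw0 i
    by_contra hc
    push Not at hc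
    nlinarith
  have e2 : vgt j * prob (fun x : Fin n → 𝒳 => ∏ k, q (x k)) (A n) ≤
      typeII (fun n x => ∑' j, vgt j * ∏ k, Pbar j (x k)) A n := by
    unfold typeII
    rw [mix_prob (fun i x => ∏ k, Pbar i (x k)) vgt hv hv0 hQn0
      (fun i x => prod_le_one' _ (fun x => ((hPbar i).1 x).le) (hPbar i).2 x)]
    exact mix_le (fun i => prob (fun x : Fin n → 𝒳 => ∏ k, Pbar i (x k)) (A n)) vgt hv hv0
      (fun i => prob_nonneg _ (hQn0 i) _)
      (fun i => prob_le_total _ (hQn0 i) (sum_prod_one _ (hPbar i).2 n) _) j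
  have e3 : prob (fun x : Fin n → 𝒳 => ∏ k, p (x k)) (A n ∩ Typ p ε n) ≤
      Real.exp (n * (KL p q + δ / 2)) * prob (fun x : Fin n → 𝒳 => ∏ k, q (x k)) (A n) := by
    unfold prob
    rw [Finset.mul_sum]
    refine Finset.sum_le_sum fun x _ => ?_
    by_cases hx : x ∈ A n ∩ Typ p ε n
    · rw [Set.indicator_of_mem hx, Set.indicator_of_mem hx.1]
      rw [prod_exp p x (typ_pos p hp0 ε n x hx.2), prod_exp q x (fun k => hq0 _), ← Real.exp_add]
      refine Real.exp_le_exp.2 ?_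
      have h := (abs_le.1 (typ_sum p ε n x hx.2 L)).2
      rw [hKL] at h
      simp only [L, Finset.sum_sub_distrib] at h
      have : ε * (n * M) ≤ n * (δ / 2) := by nlinarith
      have : ε * (n * M) = ε * (n * ∑ a, p a * |Real.log (p a) - Real.log (q a)|) := rfl
      linarith
    · rw [Set.indicator_of_notMem hx]
      exact mul_nonneg (Real.exp_pos _).le (Set.indicator_nonneg (fun x _ => hQn0 j x) x)
  have e4 := prob_compl (fun x : Fin n → 𝒳 => ∏ k, p (x k)) (A n)
  rw [sum_prod_one p hp1 n] at e4
  have e5 : prob (fun x : Fin n → 𝒳 => ∏ k, p (x k)) (A n) ≤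
      prob (fun x : Fin n → 𝒳 => ∏ k, p (x k)) (A n ∩ Typ p ε n) +
      prob (fun x : Fin n → 𝒳 => ∏ k, p (x k)) (Typ p ε n)ᶜ := by
    refine le_trans (prob_mono _ (hPn0 i) ?_) (prob_union _ (hPn0 i) _ _)
    intro x hx
    by_cases h : x ∈ Typ p ε n
    · exact Or.inl ⟨hx, h⟩
    · exact Or.inr h
  have e6 : 1 / 2 ≤ Real.exp (n * (KL p q + δ / 2)) *
      prob (fun x : Fin n → 𝒳 => ∏ k, q (x k)) (A n) := by linarith
  have e7 : vgt j / 2 * Real.exp (-(n * (KL p q + δ / 2))) ≤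
      typeII (fun n x => ∑' j, vgt j * ∏ k, Pbar j (x k)) A n := by
    refine le_trans ?_ e2
    rw [Real.exp_neg, ← div_eq_mul_inv, div_le_iff₀ (Real.exp_pos _)]
    have := mul_le_mul_of_nonneg_left e6 (hv0 j).le
    linarith
  have hvj : 0 < vgt j / 2 := half_pos (hv0 j)
  have e8 : 0 < vgt j / 2 * Real.exp (-(n * (KL p q + δ / 2))) :=
    mul_pos hvj (Real.exp_pos _)
  refine ⟨e8.trans_le e7, ?_⟩
  have e9 := Real.log_le_log e8 e7
  rw [Real.log_mul hvj.ne' (Real.exp_pos _).ne', Real.log_exp] at e9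
  rw [one_div, one_div, Real.log_inv, inv_mul_le_iff₀ hn']
  linarith

lemma achiev_aux (P : ℕ → 𝒳 → ℝ) (Pbar : ℕ → 𝒳 → ℝ)
    (hP : ∀ i, (∀ x, 0 ≤ P i x) ∧ (∑ x, P i x) = 1)
    (hPbar : ∀ j, (∀ x, 0 < Pbar j x) ∧ (∑ x, Pbar j x) = 1)
    (wgt vgt : ℕ → ℝ)
    (hw0 : ∀ i, 0 < wgt i) (hw : Summable wgt)
    (hv0 : ∀ j, 0 < vgt j) (hv : Summable vgt) (hv1 : ∑' j, vgt j = 1)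
    (D δ : ℝ) (hδ : 0 < δ) (hD : ∀ i j, D ≤ KL (P i) (Pbar j)) :
    Tendsto (typeI (fun n x => ∑' i, wgt i * ∏ k, P i (x k)) (fun n =>
      {x | (∑' j, vgt j * ∏ k, Pbar j (x k)) * Real.exp (n * (D - δ)) ≤
        ∑' i, wgt i * ∏ k, P i (x k)})) atTop (𝓝 0) := by
  have hPn0 : ∀ n i (x : Fin n → 𝒳), 0 ≤ ∏ k, P i (x k) :=
    fun n i x => Finset.prod_nonneg fun k _ => (hP i).1 _
  have hQn0 : ∀ n i (x : Fin n → 𝒳), 0 ≤ ∏ k, Pbar i (x k) :=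
    fun n i x => Finset.prod_nonneg fun k _ => ((hPbar i).1 _).le
  set A : (n : ℕ) → Set (Fin n → 𝒳) := fun n =>
      {x | (∑' j, vgt j * ∏ k, Pbar j (x k)) * Real.exp (n * (D - δ)) ≤
        ∑' i, wgt i * ∏ k, P i (x k)} with hA
  have e : typeI (fun n x => ∑' i, wgt i * ∏ k, P i (x k)) A = fun n =>
      ∑' i, wgt i * prob (fun x : Fin n → 𝒳 => ∏ k, P i (x k)) (A n)ᶜ := by
    funext n
    exact mix_prob (fun i x => ∏ k, P i (x k)) wgt hw hw0 (hPn0 n)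
      (fun i x => prod_le_one' _ (hP i).1 (hP i).2 x) _
  rw [e]
  have key : ∀ i, Tendsto (fun n => wgt i * prob (fun x : Fin n → 𝒳 => ∏ k, P i (x k)) (A n)ᶜ)
      atTop (𝓝 0) := by
    intro i
    obtain ⟨hp0, hp1⟩ := hP i
    set p := P i with hp
    have hple : ∀ a, p a ≤ 1 := fun a => by
      rw [← hp1]; exact Finset.single_le_sum (fun a _ => hp0 a) (Finset.mem_univ a)
    set H := ∑ a, p a * (-Real.log (p a)) with hH
    set B := |D + 2 * H| + 1 with hB
    have hB0 : 0 < B := by positivity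
    set ε := min 1 (δ / (2 * B)) with hε
    have hε0 : 0 < ε := lt_min one_pos (by positivity)
    have hε1 : ε ≤ 1 := min_le_left _ _
    have hεB : ε * (D + 2 * H) ≤ δ / 2 := by
      have h1 : ε * (2 * B) ≤ δ := by
        rw [← le_div_iff₀ (by positivity)]; exact min_le_right _ _
      have h2 : D + 2 * H ≤ B := by have := le_abs_self (D + 2 * H); linarith
      have := mul_le_mul_of_nonneg_left h2 hε0.le
      linarith
    have hlog : ∀ᶠ n : ℕ in atTop, - Real.log (wgt i) ≤ n * (δ / 2) :=
      (tendsto_natCast_atTop_atTop.atTop_mul_const (half_pos hδ)).eventually_ge_atTop _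
    have hsub : ∀ᶠ n : ℕ in atTop, Typ p ε n ⊆ A n := by
      filter_upwards [hlog] with n hlog x hx
      have hn' : (0 : ℝ) ≤ n := n.cast_nonneg
      have hXbar : ∑' j, vgt j * ∏ k, Pbar j (x k) ≤ Real.exp (-(n * ((1 - ε) * (D + H)))) := by
        have hj : ∀ j, ∏ k, Pbar j (x k) ≤ Real.exp (-(n * ((1 - ε) * (D + H)))) := by
          intro j
          have hqle : ∀ a, Pbar j a ≤ 1 := fun a => by
            rw [← (hPbar j).2]
            exact Finset.single_le_sum (fun a _ => ((hPbar j).1 a).le) (Finset.mem_univ a)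
          rw [prod_exp (Pbar j) x (fun k => (hPbar j).1 _)]
          refine Real.exp_le_exp.2 ?_
          have h := (abs_le.1 (typ_sum p ε n x hx (fun a => -Real.log (Pbar j a)))).1
          have hab : ∀ a, |-Real.log (Pbar j a)| = -Real.log (Pbar j a) := fun a =>
            abs_of_nonneg (neg_nonneg.2 (Real.log_nonpos ((hPbar j).1 a).le (hqle a)))
          simp only [hab] at h
          have hd := hD i j
          rw [← hp, KL_eq p _ (hPbar j).1] at hd
          simp only [mul_neg, Finset.sum_neg_distrib] at h hH
          have h5 : D + H ≤ -∑ a, p a * Real.log (Pbar j a) := by rw [hH]; linarith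
          have h6 := mul_le_mul_of_nonneg_left h5 (mul_nonneg hn' (sub_nonneg.2 hε1))
          linarith
        calc _ ≤ ∑' j, vgt j * Real.exp (-(n * ((1 - ε) * (D + H)))) :=
              (mix_summable hv hv0 (fun j => hQn0 n j x) (fun j => prod_le_one' _
                (fun x => ((hPbar j).1 x).le) (hPbar j).2 x)).tsum_le_tsum
                (fun j => mul_le_mul_of_nonneg_left (hj j) (hv0 j).le) (hv.mul_right _)
          _ = _ := by rw [tsum_mul_right, hv1, one_mul]
      have hX : Real.exp (Real.log (wgt i) - n * ((1 + ε) * H)) ≤ ∑' i, wgt i * ∏ k, P i (x k) := by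
        refine le_trans ?_ (mix_le (fun i => ∏ k, P i (x k)) wgt hw hw0 (fun i => hPn0 n i x)
          (fun i => prod_le_one' _ (hP i).1 (hP i).2 x) i)
        simp only [← hp]
        rw [prod_exp p x (typ_pos p hp0 ε n x hx)]
        rw [sub_eq_add_neg, Real.exp_add, Real.exp_log (hw0 i)]
        refine mul_le_mul_of_nonneg_left (Real.exp_le_exp.2 ?_) (hw0 i).le
        have h := (abs_le.1 (typ_sum p ε n x hx (fun a => -Real.log (p a)))).2
        have hab : ∀ a, |-Real.log (p a)| = -Real.log (p a) := fun a =>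
          abs_of_nonneg (neg_nonneg.2 (Real.log_nonpos (hp0 a) (hple a)))
        simp only [hab] at h
        rw [← hH, Finset.sum_neg_distrib] at h
        linarith
      show (∑' j, vgt j * ∏ k, Pbar j (x k)) * Real.exp (n * (D - δ)) ≤
        ∑' i, wgt i * ∏ k, P i (x k)
      refine le_trans ?_ hX
      refine (mul_le_mul_of_nonneg_right hXbar (Real.exp_pos _).le).trans ?_
      rw [← Real.exp_add]
      refine Real.exp_le_exp.2 ?_
      have := mul_le_mul_of_nonneg_left hεB hn'
      linarith
    have ht := (typ_tendsto p hp0 hp1 ε hε0).const_mul (wgt i)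
    rw [mul_zero] at ht
    refine squeeze_zero' (Eventually.of_forall fun n =>
      mul_nonneg (hw0 i).le (prob_nonneg _ (hPn0 n i) _)) ?_ ht
    filter_upwards [hsub] with n hn
    exact mul_le_mul_of_nonneg_left (prob_mono _ (hPn0 n i) (Set.compl_subset_compl.2 hn)) (hw0 i).le
  have := tendsto_tsum_of_dominated_convergence (𝓕 := atTop)
    (f := fun n i => wgt i * prob (fun x : Fin n → 𝒳 => ∏ k, P i (x k)) (A n)ᶜ)
    (g := fun _ => (0:ℝ)) hw key (Eventually.of_forall fun n i => by
      have h0 := prob_nonneg _ (hPn0 n i) (A n)ᶜ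
      rw [Real.norm_of_nonneg (mul_nonneg (hw0 i).le h0)]
      exact mul_le_of_le_one_right (hw0 i).le
        (prob_le_total _ (hPn0 n i) (sum_prod_one _ (hP i).2 n) _))
  simpa using this

end aux

/-- **Corollary 4.1:** for countable mixtures
`P_{X^n}(x) = ∑ᵢ wᵢ ∏ₖ Pᵢ(xₖ)` and `P_{X̄^n}(x) = ∑ⱼ vⱼ ∏ₖ P̄ⱼ(xₖ)` with positive
weights, if each `inf_j D(Pᵢ‖P̄ⱼ)` is attained, then
`B_0(X‖X̄) = inf_{i,j} D(Pᵢ‖P̄ⱼ)`. -/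
theorem stmt_13 {𝒳 : Type*} [Fintype 𝒳]
    (P : ℕ → 𝒳 → ℝ) (Pbar : ℕ → 𝒳 → ℝ)
    (hP : ∀ i, (∀ x, 0 ≤ P i x) ∧ (∑ x, P i x) = 1)
    (hPbar : ∀ j, (∀ x, 0 < Pbar j x) ∧ (∑ x, Pbar j x) = 1)
    (wgt vgt : ℕ → ℝ)
    (hw0 : ∀ i, 0 < wgt i) (hw1 : ∑' i, wgt i = 1)
    (hv0 : ∀ j, 0 < vgt j) (hv1 : ∑' j, vgt j = 1)
    (hattain : ∀ i, ∃ j0, KL (P i) (Pbar j0) = ⨅ j, KL (P i) (Pbar j)) :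
    B0 (fun n x => ∑' i, wgt i * ∏ k, P i (x k))
        (fun n x => ∑' j, vgt j * ∏ k, Pbar j (x k)) =
      ⨅ p : ℕ × ℕ, KL (P p.1) (Pbar p.2) := by
  have hw : Summable wgt := by
    by_contra h; rw [tsum_eq_zero_of_not_summable h] at hw1; exact zero_ne_one hw1
  have hv : Summable vgt := by
    by_contra h; rw [tsum_eq_zero_of_not_summable h] at hv1; exact zero_ne_one hv1
  have hPn0 : ∀ n i (x : Fin n → 𝒳), 0 ≤ ∏ k, P i (x k) :=
    fun n i x => Finset.prod_nonneg fun k _ => (hP i).1 _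
  have hQn0 : ∀ n i (x : Fin n → 𝒳), 0 ≤ ∏ k, Pbar i (x k) :=
    fun n i x => Finset.prod_nonneg fun k _ => ((hPbar i).1 _).le
  have hX0 : ∀ n (x : Fin n → 𝒳), 0 ≤ ∑' i, wgt i * ∏ k, P i (x k) :=
    fun n x => tsum_nonneg fun i => mul_nonneg (hw0 i).le (hPn0 n i x)
  have hY0 : ∀ n (x : Fin n → 𝒳), 0 ≤ ∑' i, vgt i * ∏ k, Pbar i (x k) :=
    fun n x => tsum_nonneg fun i => mul_nonneg (hv0 i).le (hQn0 n i x)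
  have hXs : ∀ n, ∑ x : Fin n → 𝒳, ∑' i, wgt i * ∏ k, P i (x k) = 1 := by
    intro n
    have := mix_prob (fun i (x : Fin n → 𝒳) => ∏ k, P i (x k)) wgt hw hw0 (hPn0 n)
      (fun i x => prod_le_one' _ (hP i).1 (hP i).2 x) Set.univ
    simpa [prob, sum_prod_one _ (hP _).2, hw1] using this
  have hYs : ∀ n, ∑ x : Fin n → 𝒳, ∑' i, vgt i * ∏ k, Pbar i (x k) = 1 := by
    intro n
    have := mix_prob (fun i (x : Fin n → 𝒳) => ∏ k, Pbar i (x k)) vgt hv hv0 (hQn0 n)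
      (fun i x => prod_le_one' _ (fun x => ((hPbar i).1 x).le) (hPbar i).2 x) Set.univ
    simpa [prob, sum_prod_one _ (hPbar _).2, hv1] using this
  have hbdd : BddBelow (Set.range fun p : ℕ × ℕ => KL (P p.1) (Pbar p.2)) := by
    refine ⟨0, ?_⟩
    rintro _ ⟨p, rfl⟩
    exact KL_nonneg' _ _ (hP _).1 (hP _).2 (hPbar _).1 (hPbar _).2
  set D := ⨅ p : ℕ × ℕ, KL (P p.1) (Pbar p.2) with hDdef
  have hD : ∀ i j, D ≤ KL (P i) (Pbar j) := fun i j => ciInf_le hbdd (i, j)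
  have hach : ∀ δ > 0, EpsAchievable (fun n x => ∑' i, wgt i * ∏ k, P i (x k))
        (fun n x => ∑' j, vgt j * ∏ k, Pbar j (x k)) 0 (D - δ) := by
    intro δ hδ
    have ht := achiev_aux P Pbar hP hPbar wgt vgt hw0 hw hv0 hv hv1 D δ hδ hD
    refine ⟨_, ht.limsup_eq.le, ?_⟩
    have hc := converse_aux P Pbar hP hPbar wgt vgt hw0 hw hv0 hv _
      (fun c hc => ht.eventually (gt_mem_nhds hc)) 0 0 1 one_pos
    refine Filter.le_liminf_of_le
      (Filter.IsBoundedUnder.isCoboundedUnder_ge ⟨_, Filter.eventually_map.2 (hc.mono fun n h => h.2)⟩) ?_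
    filter_upwards [hc, Filter.eventually_gt_atTop 0] with n hn hn0
    have hn' : (0 : ℝ) < n := by exact_mod_cast hn0
    obtain ⟨hpos, -⟩ := hn
    rw [one_div, one_div, Real.log_inv, le_inv_mul_iff₀ hn', le_neg,
      Real.log_le_iff_le_exp hpos, Real.exp_neg, ← one_div, le_div_iff₀ (Real.exp_pos _), ← hXs n]
    unfold typeII prob
    rw [Finset.sum_mul]
    refine Finset.sum_le_sum fun x _ => ?_
    by_cases hx : (∑' j, vgt j * ∏ k, Pbar j (x k)) * Real.exp (n * (D - δ)) ≤
        ∑' i, wgt i * ∏ k, P i (x k)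
    · rw [Set.indicator_of_mem (by exact hx)]; exact hx
    · rw [Set.indicator_of_notMem (by exact hx), zero_mul]; exact hX0 n x
  have hconv : ∀ R, EpsAchievable (fun n x => ∑' i, wgt i * ∏ k, P i (x k))
        (fun n x => ∑' j, vgt j * ∏ k, Pbar j (x k)) 0 R → R ≤ D := by
    rintro R ⟨A, h1, h2⟩
    refine le_ciInf fun ⟨i, j⟩ => le_of_forall_pos_le_add fun δ hδ => h2.trans ?_
    have hc := converse_aux P Pbar hP hPbar wgt vgt hw0 hw hv0 hv A (fun c hc => by
      refine Filter.eventually_lt_of_limsup_lt (h1.trans_lt hc)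
        ⟨1, Filter.eventually_map.2 (Filter.Eventually.of_forall fun n => ?_)⟩
      exact prob_le_total _ (hX0 n) (hXs n) _) i j δ hδ
    refine Filter.liminf_le_of_frequently_le (hc.mono fun n h => h.2).frequently
      ⟨0, Filter.eventually_map.2 (hc.mono fun n h => ?_)⟩
    refine mul_nonneg (by positivity) (Real.log_nonneg ?_)
    rw [le_div_iff₀ h.1, one_mul]
    exact prob_le_total _ (hY0 n) (hYs n) _
  unfold B0 Beps
  refine csSup_eq_of_forall_le_of_forall_lt_exists_gt ⟨D - 1, hach 1 one_pos⟩ hconv ?_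
  intro w hwD
  exact ⟨D - (D - w) / 2, hach _ (by linarith), by linarith⟩
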